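/- Let A be a unital C*-algebra and let c ∈ A with ‖c‖ < 1/2. Then c lies in the absolute convex hull of the unitary group of A: there exist unitary elements u₁, u₂, u₃, u₄ ∈ A and complex numbers λ₁, λ₂, λ₃, λ₄ with |λ₁| + |λ₂| + |λ₃| + |λ₄| ≤ 1 such that c = λ₁u₁ + λ₂u₂ + λ₃u₃ + λ₄u₄. (Hence the absolute convex hull of the unitary group of A is a 0-neighborhood in A.) -/

import Mathlib

/-- In a unital C*-algebra, every element of norm `< 1/2` lies in the absolute
convex hull of the unitary group: it is a combination `Σ λⱼ uⱼ` of four unitaries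
with `Σ |λⱼ| ≤ 1`. -/
theorem mem_absConvexHull_unitary_of_norm_lt_half {A : Type*} [NormedRing A]
    [StarRing A] [CStarRing A] [CompleteSpace A] [NormedAlgebra ℂ A]
    [StarModule ℂ A]
    (c : A) (hc : ‖c‖ < 1 / 2) :
    ∃ (u₁ u₂ u₃ u₄ : A) (l₁ l₂ l₃ l₄ : ℂ),
      u₁ ∈ unitary A ∧ u₂ ∈ unitary A ∧ u₃ ∈ unitary A ∧ u₄ ∈ unitary A ∧
      ‖l₁‖ + ‖l₂‖ + ‖l₃‖ + ‖l₄‖ ≤ 1 ∧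
      c = l₁ • u₁ + l₂ • u₂ + l₃ • u₃ + l₄ • u₄ := by
  let _ : CStarAlgebra A := {}
  obtain ⟨u, l, hl, hnorm⟩ := CStarAlgebra.exists_sum_four_unitary c
  refine ⟨u 0, u 1, u 2, u 3, l 0, l 1, l 2, l 3, (u 0).2, (u 1).2, (u 2).2, (u 3).2, ?_, ?_⟩
  · linarith [hnorm 0, hnorm 1, hnorm 2, hnorm 3]
  · rwa [Fin.sum_univ_four] at hl
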